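/- (Stefan's theorem) Let k ≥ 1, let f : ℝ → ℝ be continuous, and let B = {β₁ < β₂ < ⋯ < β_{2k+1}} be a (2k+1)-orbit of f such that f has no periodic point of odd period q with 1 < q < 2k+1 whose forward orbit is contained in [β₁, β_{2k+1}] (i.e. B is a minimal odd orbit). Then the permutation σ of B equals the Stefan permutation π_S or its reversal conjugate ω ∘ π_S ∘ ω. -/

import Mathlib

/-- `x` is a periodic point of `f` of (exact) period `n`. -/
def PeriodicPtOfPeriod (f : ℝ → ℝ) (n : ℕ) (x : ℝ) : Prop :=
  f^[n] x = x ∧ ∀ j, 1 ≤ j → j < n → f^[j] x ≠ x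

/-- `β 1 < β 2 < ⋯ < β m` is an `m`-orbit of `f` with permutation `σ`:
each `β t` is a periodic point of period `m`, `σ` permutes `{1,…,m}`,
and `f (β t) = β (σ t)`. -/
def IsOrbitWithPerm (f : ℝ → ℝ) (m : ℕ) (β : ℕ → ℝ) (σ : ℕ → ℕ) : Prop :=
  StrictMonoOn β (Set.Icc 1 m) ∧
  (∀ t ∈ Set.Icc 1 m, PeriodicPtOfPeriod f m (β t)) ∧
  Set.BijOn σ (Set.Icc 1 m) (Set.Icc 1 m) ∧
  (∀ t ∈ Set.Icc 1 m, f (β t) = β (σ t))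

/-- The Stefan permutation of `{1,…,2k+1}`. -/
def stefanPerm (k : ℕ) (t : ℕ) : ℕ :=
  if t = 1 then k+1 else if t ≤ k+1 then 2*k+3-t else 2*k+2-t

open Set Function

/-- A continuous function on a segment whose end values enclose `[c, d]` maps some subsegment
into `[c, d]`, with end points going to end points. -/
lemma exists_subsegment_of_le {g : ℝ → ℝ} (hg : Continuous g) {a b c d : ℝ} (hab : a ≤ b)
    (hcd : c ≤ d) (ha : g a ≤ c) (hb : d ≤ g b) :
    ∃ a' b', a' ∈ Icc a b ∧ b' ∈ Icc a b ∧ a' ≤ b' ∧ g a' = c ∧ g b' = d ∧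
      ∀ x ∈ Icc a' b', g x ∈ Icc c d := by
  obtain ⟨a', ⟨⟨ha1, ha2⟩, ha3⟩, ha4⟩ := (isCompact_Icc.inter_right
    (isClosed_Iic.preimage hg) : IsCompact (Icc a b ∩ g ⁻¹' Iic c)).exists_isGreatest
    ⟨a, ⟨le_rfl, hab⟩, ha⟩
  obtain ⟨b', ⟨⟨hb1, hb2⟩, hb3⟩, hb4⟩ := (isCompact_Icc.inter_right
    (isClosed_Ici.preimage hg) : IsCompact (Icc a' b ∩ g ⁻¹' Ici d)).exists_isLeast
    ⟨b, ⟨ha2, le_rfl⟩, hb⟩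
  simp only [mem_preimage, mem_Iic, mem_Ici] at ha3 hb3
  have hlow : ∀ x ∈ Icc a' b, c ≤ g x := by
    intro x hx
    by_contra! h
    obtain ⟨y, hy, hyc⟩ := intermediate_value_Icc hx.2 hg.continuousOn ⟨h.le, hcd.trans hb⟩
    have hya : y ≤ a' := ha4 ⟨⟨ha1.trans (hx.1.trans hy.1), hy.2⟩, hyc.le⟩
    have : x = y := le_antisymm hy.1 (hya.trans hx.1)
    subst this
    exact h.ne hyc
  have hupp : ∀ x ∈ Icc a' b', g x ≤ d := by
    intro x hx
    by_contra! h
    obtain ⟨y, hy, hyd⟩ := intermediate_value_Icc hx.1 hg.continuousOn ⟨ha3.trans hcd, h.le⟩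
    have hyb : b' ≤ y := hb4 ⟨⟨hy.1, hy.2.trans (hx.2.trans hb2)⟩, hyd.ge⟩
    have : x = y := le_antisymm (hx.2.trans hyb) hy.2
    subst this
    exact h.ne' hyd
  refine ⟨a', b', ⟨ha1, ha2⟩, ⟨ha1.trans hb1, hb2⟩, hb1, ?_, ?_, ?_⟩
  · exact le_antisymm ha3 (hlow _ ⟨le_rfl, ha2⟩)
  · exact le_antisymm (hupp _ ⟨hb1, le_rfl⟩) hb3
  · exact fun x hx => ⟨hlow x ⟨hx.1, hx.2.trans hb2⟩, hupp x hx⟩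

lemma exists_subsegment {g : ℝ → ℝ} (hg : Continuous g) {a b c d : ℝ}
    (hcd : c ≤ d) (ha : g a ≤ c) (hb : d ≤ g b) :
    ∃ a' b', a' ∈ uIcc a b ∧ b' ∈ uIcc a b ∧ g a' = c ∧ g b' = d ∧
      ∀ x ∈ uIcc a' b', g x ∈ Icc c d := by
  rcases le_total a b with hab | hab
  · obtain ⟨a', b', h1, h2, h3, h4, h5, h6⟩ := exists_subsegment_of_le hg hab hcd ha hb
    rw [uIcc_of_le hab]
    exact ⟨a', b', h1, h2, h4, h5, by rwa [uIcc_of_le h3]⟩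
  · obtain ⟨a', b', h1, h2, h3, h4, h5, h6⟩ := exists_subsegment_of_le
      (g := fun x => g (-x)) (by fun_prop) (neg_le_neg hab) hcd (by simpa using ha)
      (by simpa using hb)
    rw [uIcc_of_ge hab]
    refine ⟨-a', -b', ⟨by linarith [h1.2], by linarith [h1.1]⟩,
      ⟨by linarith [h2.2], by linarith [h2.1]⟩, h4, h5, ?_⟩
    rw [uIcc_of_ge (neg_le_neg h3)]
    intro x hx
    simpa using h6 (-x) ⟨by linarith [hx.2], by linarith [hx.1]⟩

lemma exists_fixedPoint_of_expanding {g : ℝ → ℝ} (hg : Continuous g) {a b : ℝ}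
    (ha : g a ≤ a) (hb : b ≤ g b) : ∃ x ∈ uIcc a b, g x = x := by
  obtain ⟨x, hx, hx0⟩ := intermediate_value_uIcc (a := a) (b := b)
    (f := fun x => g x - x) (by fun_prop) (mem_uIcc_of_le (x := (0 : ℝ)) (by linarith) (by linarith))
  exact ⟨x, hx, by linarith⟩

lemma periodicPtOfPeriod_iff {f : ℝ → ℝ} {n : ℕ} (hn : 0 < n) {x : ℝ} :
    PeriodicPtOfPeriod f n x ↔ minimalPeriod f x = n := by
  constructor
  · rintro ⟨h1, h2⟩
    have hp : IsPeriodicPt f n x := h1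
    refine le_antisymm (hp.minimalPeriod_le hn) ?_
    by_contra! h
    exact h2 _ (hp.minimalPeriod_pos hn) h (iterate_minimalPeriod)
  · rintro rfl
    exact ⟨iterate_minimalPeriod, fun j hj hjn h =>
      not_isPeriodicPt_of_pos_of_lt_minimalPeriod (by lia) hjn h⟩

/-- The `K`-th gap between consecutive points is stretched by `σ` over the `L`-th gap. -/
def GapCovers (σ : ℕ → ℕ) (K L : ℕ) : Prop :=
  (σ K ≤ L ∧ L + 1 ≤ σ (K + 1)) ∨ (σ (K + 1) ≤ L ∧ L + 1 ≤ σ K)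

/-- A discrete intermediate value theorem. -/
lemma exists_gapCovers {σ : ℕ → ℕ} {l r x y L : ℕ} (hx : x ∈ Icc l r) (hy : y ∈ Icc l r)
    (hxL : σ x ≤ L) (hyL : L + 1 ≤ σ y) : ∃ K, l ≤ K ∧ K < r ∧ GapCovers σ K L := by
  by_contra! h
  have key : ∀ d, l + d ≤ r → (σ (l + d) ≤ L ↔ σ l ≤ L) := by
    intro d
    induction d with
    | zero => simp
    | succ d ih =>
      intro hd
      have h1 := ih (by lia)
      have h2 := h (l + d) (by lia) (by lia)
      unfold GapCovers at h2
      rw [← add_assoc]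
      lia
  obtain ⟨hx1, hx2⟩ := hx
  obtain ⟨hy1, hy2⟩ := hy
  have h1 := key (x - l) (by lia)
  have h2 := key (y - l) (by lia)
  rw [Nat.add_sub_cancel' hx1] at h1
  rw [Nat.add_sub_cancel' hy1] at h2
  lia

/-- The gap `K` is reached from the gap `j` in `i` steps by a segment of `f`-orbits staying
between `β 1` and `β n`. -/
def GapReached (f : ℝ → ℝ) (β : ℕ → ℝ) (n j i K : ℕ) : Prop :=
  ∃ a b, a ∈ Icc (β j) (β (j + 1)) ∧ b ∈ Icc (β j) (β (j + 1)) ∧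
    (∀ x ∈ uIcc a b, (∀ m ≤ i, f^[m] x ∈ Icc (β 1) (β n)) ∧
      f^[i] x ∈ Icc (β K) (β (K + 1))) ∧ f^[i] a = β K ∧ f^[i] b = β (K + 1)

section Orbit

variable {f : ℝ → ℝ} {n j i K L : ℕ} {β : ℕ → ℝ} {σ : ℕ → ℕ}

lemma IsOrbitWithPerm.mono (h : IsOrbitWithPerm f n β σ) {s t : ℕ} (hs : 1 ≤ s) (hst : s ≤ t)
    (ht : t ≤ n) : β s ≤ β t :=
  h.1.monotoneOn ⟨hs, hst.trans ht⟩ ⟨hs.trans hst, ht⟩ hst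

lemma IsOrbitWithPerm.perm_mem (h : IsOrbitWithPerm f n β σ) {t : ℕ} (h1 : 1 ≤ t) (ht : t ≤ n) :
    1 ≤ σ t ∧ σ t ≤ n :=
  h.2.2.1.mapsTo ⟨h1, ht⟩

lemma IsOrbitWithPerm.apply_ne (h : IsOrbitWithPerm f n β σ) (hn : 1 < n) {t : ℕ} (h1 : 1 ≤ t)
    (ht : t ≤ n) : f (β t) ≠ β t :=
  (h.2.1 t ⟨h1, ht⟩).2 1 le_rfl hn

lemma IsOrbitWithPerm.perm_ne (h : IsOrbitWithPerm f n β σ) (hn : 1 < n) {t : ℕ} (h1 : 1 ≤ t)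
    (ht : t ≤ n) : σ t ≠ t := by
  intro he
  apply h.apply_ne hn h1 ht
  rw [h.2.2.2 t ⟨h1, ht⟩, he]

lemma IsOrbitWithPerm.gapReached_zero (h : IsOrbitWithPerm f n β σ) (hj : 1 ≤ j) (hjn : j < n) :
    GapReached f β n j 0 j := by
  have hle : β j ≤ β (j + 1) := h.mono hj (by lia) hjn
  refine ⟨β j, β (j + 1), ⟨le_rfl, hle⟩, ⟨hle, le_rfl⟩, ?_, rfl, rfl⟩
  rw [uIcc_of_le hle]
  intro x hx
  refine ⟨fun m hm => ?_, hx⟩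
  obtain rfl : m = 0 := by lia
  exact ⟨(h.mono le_rfl hj hjn.le).trans hx.1, hx.2.trans (h.mono (by lia) hjn le_rfl)⟩

/-- Pulling a covered gap back along a segment reaching the covering gap. -/
lemma IsOrbitWithPerm.exists_segment (h : IsOrbitWithPerm f n β σ) (hf : Continuous f)
    (hK : 1 ≤ K) (hKn : K < n) (hL : 1 ≤ L) (hLn : L < n) (hc : GapCovers σ K L) {a b : ℝ}
    (ha : f^[i] a = β K) (hb : f^[i] b = β (K + 1)) :
    ∃ a' b', a' ∈ uIcc a b ∧ b' ∈ uIcc a b ∧ f^[i + 1] a' = β L ∧ f^[i + 1] b' = β (L + 1) ∧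
      ∀ x ∈ uIcc a' b', f^[i + 1] x ∈ Icc (β L) (β (L + 1)) := by
  have hg : Continuous f^[i + 1] := hf.iterate _
  have hLL : β L ≤ β (L + 1) := h.mono hL (by lia) hLn
  have ha' : f^[i + 1] a = β (σ K) := by
    rw [iterate_succ_apply', ha, h.2.2.2 K ⟨hK, hKn.le⟩]
  have hb' : f^[i + 1] b = β (σ (K + 1)) := by
    rw [iterate_succ_apply', hb, h.2.2.2 (K + 1) ⟨by lia, hKn⟩]
  have h1 := h.perm_mem hK hKn.le
  have h2 := h.perm_mem (t := K + 1) (by lia) hKn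
  rcases hc with ⟨hc1, hc2⟩ | ⟨hc1, hc2⟩
  · exact exists_subsegment hg hLL (ha' ▸ h.mono h1.1 hc1 hLn.le)
      (hb' ▸ h.mono (by lia) hc2 h2.2)
  · rw [uIcc_comm a b]
    exact exists_subsegment hg hLL (hb' ▸ h.mono h2.1 hc1 hLn.le)
      (ha' ▸ h.mono (by lia) hc2 h1.2)

lemma IsOrbitWithPerm.gapReached_succ (h : IsOrbitWithPerm f n β σ) (hf : Continuous f)
    (hK : 1 ≤ K) (hKn : K < n) (hL : 1 ≤ L) (hLn : L < n) (hc : GapCovers σ K L)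
    (hr : GapReached f β n j i K) : GapReached f β n j (i + 1) L := by
  obtain ⟨a, b, ha, hb, hab, hfa, hfb⟩ := hr
  obtain ⟨a', b', ha', hb', hfa', hfb', hx'⟩ := h.exists_segment hf hK hKn hL hLn hc hfa hfb
  have hsub : uIcc a b ⊆ Icc (β j) (β (j + 1)) := uIcc_subset_Icc ha hb
  refine ⟨a', b', hsub ha', hsub hb', fun x hx => ⟨fun m hm => ?_, hx' x hx⟩, hfa', hfb'⟩
  rcases Nat.lt_or_ge m (i + 1) with hm' | hm'
  · exact (hab x (uIcc_subset_uIcc ha' hb' hx)).1 m (by lia)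
  · obtain rfl : m = i + 1 := by lia
    have := hx' x hx
    exact ⟨(h.mono le_rfl hL hLn.le).trans this.1,
      this.2.trans (h.mono (by lia) hLn le_rfl)⟩

/-- A loop of odd length through two distinct gaps yields a nontrivial odd period. -/
lemma IsOrbitWithPerm.exists_periodicPt_of_loop (h : IsOrbitWithPerm f n β σ)
    (hf : Continuous f) (hn : 1 < n) (hi : Odd (i + 1)) (hK : 1 ≤ K) (hKn : K < n) (hj : 1 ≤ j)
    (hjn : j < n) (hKj : K ≠ j) (hc : GapCovers σ K j) (hr : GapReached f β n j i K) :
    ∃ q, Odd q ∧ 1 < q ∧ q ≤ i + 1 ∧ ∃ y, PeriodicPtOfPeriod f q y ∧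
      ∀ m : ℕ, f^[m] y ∈ Icc (β 1) (β n) := by
  obtain ⟨a, b, ha, hb, hab, hfa, hfb⟩ := hr
  obtain ⟨a', b', ha', hb', hfa', hfb', hx'⟩ := h.exists_segment hf hK hKn hj hjn hc hfa hfb
  have hsub : uIcc a b ⊆ Icc (β j) (β (j + 1)) := uIcc_subset_Icc ha hb
  obtain ⟨x, hx, hfx⟩ := exists_fixedPoint_of_expanding (hf.iterate (i + 1))
    (hfa'.le.trans (hsub ha').1) ((hsub hb').2.trans hfb'.ge)
  have hxab := uIcc_subset_uIcc ha' hb' hx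
  have hper : IsPeriodicPt f (i + 1) x := hfx
  have hdvd := hper.minimalPeriod_dvd
  have hpos := hper.minimalPeriod_pos (Nat.succ_pos i)
  have hodd : Odd (minimalPeriod f x) := hi.of_dvd_nat hdvd
  refine ⟨minimalPeriod f x, hodd, ?_, Nat.le_of_dvd (Nat.succ_pos i) hdvd, x,
    (periodicPtOfPeriod_iff hpos).2 rfl, fun m => ?_⟩
  · by_contra! hle
    have hfix : IsFixedPt f x := minimalPeriod_eq_one_iff_isFixedPt.1 (by lia)
    have hxj := hsub hxab
    have hxK := (hab x hxab).2
    rw [(hfix.iterate i).eq] at hxK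
    rcases lt_or_gt_of_ne hKj with hlt | hlt
    · have : x = β j :=
        le_antisymm (hxK.2.trans (h.mono (by lia) hlt hjn.le)) hxj.1
      exact h.apply_ne hn hj hjn.le (this ▸ hfix)
    · have : x = β K :=
        le_antisymm (hxj.2.trans (h.mono (by lia) hlt hKn.le)) hxK.1
      exact h.apply_ne hn hK hKn.le (this ▸ hfix)
  · rw [← hper.iterate_mod_apply m]
    exact (hab x hxab).1 _ (Nat.lt_succ_iff.1 (Nat.mod_lt _ (Nat.succ_pos i)))

/-- An orbit has no proper nonempty invariant subset of consecutive points. -/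
lemma IsOrbitWithPerm.le_length_of_invariant (h : IsOrbitWithPerm f n β σ) {l r : ℕ}
    (hl : 1 ≤ l) (hlr : l ≤ r) (hr : r ≤ n) (hinv : ∀ t ∈ Icc l r, σ t ∈ Icc l r) :
    n + l ≤ r + 1 := by
  have hmem : ∀ i, σ^[i] l ∈ Icc l r := by
    intro i
    induction i with
    | zero => exact ⟨le_rfl, hlr⟩
    | succ i ih => rw [iterate_succ_apply']; exact hinv _ ih
  have hiter : ∀ i, f^[i] (β l) = β (σ^[i] l) := by
    intro i
    induction i with
    | zero => rfl
    | succ i ih =>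
      rw [iterate_succ_apply', iterate_succ_apply', ih]
      exact h.2.2.2 _ ⟨hl.trans (hmem i).1, (hmem i).2.trans hr⟩
  have hper : minimalPeriod f (β l) = n :=
    (periodicPtOfPeriod_iff (by lia)).1 (h.2.1 l ⟨hl, hlr.trans hr⟩)
  have hcard : (Finset.range n).card ≤ (Finset.Icc l r).card := by
    refine Finset.card_le_card_of_injOn (fun i => σ^[i] l) (fun i _ => ?_) ?_
    · simpa using hmem i
    · intro s hs t ht hst
      refine iterate_injOn_Iio_minimalPeriod (f := f) (x := β l) ?_ ?_ ?_
      · simpa [hper] using hs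
      · simpa [hper] using ht
      · change f^[s] (β l) = f^[t] (β l)
        rw [hiter, hiter]
        exact congrArg β hst
  simp only [Finset.card_range, Nat.card_Icc] at hcard
  lia

/-- Some gap is flipped over itself. -/
lemma IsOrbitWithPerm.exists_flipped_gap (h : IsOrbitWithPerm f n β σ) (hn : 1 < n) :
    ∃ j, 1 ≤ j ∧ j < n ∧ j + 1 ≤ σ j ∧ σ (j + 1) ≤ j := by
  obtain ⟨j, ⟨⟨hj1, hj2⟩, hj3⟩, hmax⟩ := ((finite_Icc 1 n).inter_of_left
    {t | t < σ t}).exists_maximal ⟨1, ⟨le_rfl, hn.le⟩, lt_of_le_of_ne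
      (h.perm_mem le_rfl hn.le).1 (h.perm_ne hn le_rfl hn.le).symm⟩
  simp only [mem_ofPred_eq] at hj3
  have hjn : j < n := hj3.trans_le (h.perm_mem hj1 hj2).2
  refine ⟨j, hj1, hjn, hj3, ?_⟩
  by_contra! hlt
  have hne := h.perm_ne hn (t := j + 1) (by lia) hjn
  have := hmax (y := j + 1) ⟨⟨by lia, hjn⟩, by simp only [mem_ofPred_eq]; lia⟩ (by simp)
  simp at this

end Orbit

/-- The intervals `[l i, r i]` grow from `[j, j + 1]`, each being the hull of the image under `σ`
of the previous one. -/
structure IsHullSeq (σ : ℕ → ℕ) (j : ℕ) (l r : ℕ → ℕ) : Prop where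
  left_zero : l 0 = j
  right_zero : r 0 = j + 1
  mem : ∀ i t, l i ≤ t → t ≤ r i → l (i + 1) ≤ σ t ∧ σ t ≤ r (i + 1)
  left_attained : ∀ i, ∃ t, l i ≤ t ∧ t ≤ r i ∧ σ t = l (i + 1)
  right_attained : ∀ i, ∃ t, l i ≤ t ∧ t ≤ r i ∧ σ t = r (i + 1)

lemma exists_isHullSeq (σ : ℕ → ℕ) (j : ℕ) : ∃ l r, IsHullSeq σ j l r := by
  let p : ℕ → ℕ × ℕ := fun i => Nat.rec (j, j + 1)
    (fun _ q => (sInf (σ '' Icc q.1 q.2), sSup (σ '' Icc q.1 q.2))) i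
  have hbdd : ∀ a b, BddAbove (σ '' Icc a b) := fun a b => ((finite_Icc a b).image σ).bddAbove
  have hl : ∀ i, (p (i + 1)).1 = sInf (σ '' Icc (p i).1 (p i).2) := fun _ => rfl
  have hr : ∀ i, (p (i + 1)).2 = sSup (σ '' Icc (p i).1 (p i).2) := fun _ => rfl
  have hmem : ∀ i t, (p i).1 ≤ t → t ≤ (p i).2 →
      (p (i + 1)).1 ≤ σ t ∧ σ t ≤ (p (i + 1)).2 := fun i t h1 h2 =>
    ⟨hl i ▸ Nat.sInf_le (mem_image_of_mem σ ⟨h1, h2⟩),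
      hr i ▸ le_csSup (hbdd _ _) (mem_image_of_mem σ ⟨h1, h2⟩)⟩
  have hle : ∀ i, (p i).1 ≤ (p i).2 := by
    intro i
    induction i with
    | zero => exact Nat.le_succ j
    | succ i ih => exact (hmem i _ le_rfl ih).1.trans (hmem i _ le_rfl ih).2
  have hne : ∀ i, (σ '' Icc (p i).1 (p i).2).Nonempty := fun i => (nonempty_Icc.2 (hle i)).image σ
  refine ⟨fun i => (p i).1, fun i => (p i).2, rfl, rfl, hmem, fun i => ?_, fun i => ?_⟩
  · obtain ⟨t, ht, hts⟩ := Nat.sInf_mem (hne i)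
    exact ⟨t, ht.1, ht.2, hts⟩
  · obtain ⟨t, ht, hts⟩ := Nat.sSup_mem (hne i) (hbdd _ _)
    exact ⟨t, ht.1, ht.2, hts⟩

namespace IsHullSeq

variable {f : ℝ → ℝ} {n j : ℕ} {β : ℕ → ℝ} {σ l r : ℕ → ℕ}

lemma le (H : IsHullSeq σ j l r) (i : ℕ) : l i ≤ r i := by
  obtain _ | i := i
  · rw [H.left_zero, H.right_zero]
    lia
  · obtain ⟨t, h1, h2, -⟩ := H.left_attained i
    exact (H.mem i t h1 h2).1.trans (H.mem i t h1 h2).2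

lemma nested (H : IsHullSeq σ j l r) (h1 : j + 1 ≤ σ j) (h2 : σ (j + 1) ≤ j) (i : ℕ) :
    l (i + 1) ≤ l i ∧ r i ≤ r (i + 1) := by
  induction i with
  | zero =>
    have h3 := H.mem 0 j (by rw [H.left_zero]) (by rw [H.right_zero]; lia)
    have h4 := H.mem 0 (j + 1) (by rw [H.left_zero]; lia) (by rw [H.right_zero])
    rw [H.left_zero, H.right_zero]
    lia
  | succ i ih =>
    obtain ⟨s, hs1, hs2, hs3⟩ := H.left_attained i
    obtain ⟨t, ht1, ht2, ht3⟩ := H.right_attained i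
    have h3 := H.mem (i + 1) s (by lia) (by lia)
    have h4 := H.mem (i + 1) t (by lia) (by lia)
    lia

lemma nested_le (H : IsHullSeq σ j l r) (h1 : j + 1 ≤ σ j) (h2 : σ (j + 1) ≤ j) {i i' : ℕ}
    (hi : i ≤ i') : l i' ≤ l i ∧ r i ≤ r i' :=
  ⟨antitone_nat_of_succ_le (fun i => (H.nested h1 h2 i).1) hi,
    monotone_nat_of_le_succ (fun i => (H.nested h1 h2 i).2) hi⟩

lemma bounds (H : IsHullSeq σ j l r) (hj : 1 ≤ j) (hjn : j < n)
    (hσ : MapsTo σ (Icc 1 n) (Icc 1 n)) (i : ℕ) : 1 ≤ l i ∧ r i ≤ n := by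
  induction i with
  | zero => rw [H.left_zero, H.right_zero]; lia
  | succ i ih =>
    obtain ⟨s, hs1, hs2, hs3⟩ := H.left_attained i
    obtain ⟨t, ht1, ht2, ht3⟩ := H.right_attained i
    have h1 := hσ (x := s) ⟨by lia, by lia⟩
    have h2 := hσ (x := t) ⟨by lia, by lia⟩
    rw [mem_Icc] at h1 h2
    lia

lemma gapReached (H : IsHullSeq σ j l r) (h : IsOrbitWithPerm f n β σ) (hf : Continuous f)
    (hj : 1 ≤ j) (hjn : j < n) (i : ℕ) :
    ∀ K, l i ≤ K → K < r i → GapReached f β n j i K := by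
  have hb := H.bounds hj hjn h.2.2.1.mapsTo
  induction i with
  | zero =>
    intro K h1 h2
    rw [H.left_zero] at h1
    rw [H.right_zero] at h2
    obtain rfl : K = j := by lia
    exact h.gapReached_zero hj hjn
  | succ i ih =>
    intro L h1 h2
    obtain ⟨s, hs1, hs2, hs3⟩ := H.left_attained i
    obtain ⟨t, ht1, ht2, ht3⟩ := H.right_attained i
    obtain ⟨K, hK1, hK2, hc⟩ := exists_gapCovers (σ := σ) (L := L) ⟨hs1, hs2⟩ ⟨ht1, ht2⟩
      (by lia) (by lia)
    have hbi := hb i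
    have hbi' := hb (i + 1)
    exact h.gapReached_succ hf (by lia) (by lia) (by lia) (by lia) hc (ih K hK1 hK2)

lemma growth (H : IsHullSeq σ j l r) (h : IsOrbitWithPerm f n β σ) (hj : 1 ≤ j) (hjn : j < n)
    (h1 : j + 1 ≤ σ j) (h2 : σ (j + 1) ≤ j) (i d : ℕ) :
    n ≤ r (i + d) + 1 - l (i + d) ∨ r i - l i + d ≤ r (i + d) - l (i + d) := by
  have hb := H.bounds hj hjn h.2.2.1.mapsTo
  induction d with
  | zero => right; rfl
  | succ d ih =>
    rw [← add_assoc]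
    have hn := H.nested h1 h2 (i + d)
    have hle := H.le (i + d)
    by_cases hlt : l (i + d + 1) < l (i + d) ∨ r (i + d) < r (i + d + 1)
    · lia
    · have h3 := h.le_length_of_invariant (hb (i + d)).1 hle (hb (i + d)).2 (fun t ht => by
        have := H.mem (i + d) t ht.1 ht.2
        rw [mem_Icc]
        lia)
      lia

lemma reflect (H : IsHullSeq σ j l r) (hb : ∀ i, 1 ≤ l i ∧ r i ≤ n) :
    IsHullSeq (fun t => n + 1 - σ (n + 1 - t)) (n - j) (fun i => n + 1 - r i)
      (fun i => n + 1 - l i) where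
  left_zero := by
    rw [H.right_zero]
    lia
  right_zero := by
    have := hb 0
    rw [H.left_zero, H.right_zero] at this
    rw [H.left_zero]
    lia
  mem i t h1 h2 := by
    have := hb i
    have := H.mem i (n + 1 - t) (by lia) (by lia)
    lia
  left_attained i := by
    obtain ⟨t, h1, h2, h3⟩ := H.right_attained i
    have := hb i
    exact ⟨n + 1 - t, by lia, by lia, by rw [Nat.sub_sub_self (by lia), h3]⟩
  right_attained i := by
    obtain ⟨t, h1, h2, h3⟩ := H.left_attained i
    have := hb i
    exact ⟨n + 1 - t, by lia, by lia, by rw [Nat.sub_sub_self (by lia), h3]⟩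

/-- If the hulls grow by one point at a time, starting to the left, and points change sides, then
`σ` spirals outwards. -/
lemma spiral {k : ℕ} (H : IsHullSeq σ j l r) (hlen : ∀ i < 2 * k, r i = l i + i + 1)
    (hleft : ∀ t, l (2 * k - 2) ≤ t → t ≤ j → j + 1 ≤ σ t)
    (hright : ∀ t, j + 1 ≤ t → t ≤ r (2 * k - 2) → σ t ≤ j)
    (hnest : ∀ i i', i ≤ i' → l i' ≤ l i ∧ r i ≤ r i')
    (hl1 : l 1 + 1 = j) (s : ℕ) (hs : s < k) :
    l (2 * s) + s = j ∧ r (2 * s) = j + 1 + s ∧ l (2 * s + 1) + s + 1 = j ∧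
      r (2 * s + 1) = j + 1 + s ∧ σ (j - s) = j + 1 + s ∧ σ (j + 1 + s) + s + 1 = j := by
  have hl0 := H.left_zero
  have hr0 := H.right_zero
  induction s with
  | zero =>
    have hr1 := hlen 1 (by lia)
    have hn := hnest 0 (2 * k - 2) (by lia)
    have h1 := hleft j (by lia) le_rfl
    have h2 := hright (j + 1) le_rfl (by lia)
    have h3 := H.mem 0 j (by lia) (by lia)
    have h4 := H.mem 0 (j + 1) (by lia) (by lia)
    obtain ⟨t, ht1, ht2, ht3⟩ := H.left_attained 0
    have ht : t = j ∨ t = j + 1 := by lia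
    simp only [mul_zero, zero_add, add_zero, Nat.sub_zero] at *
    rcases ht with rfl | rfl <;> lia
  | succ s ih =>
    obtain ⟨e1, e2, e3, e4, e5, e6⟩ := ih (by lia)
    have hstep1 : r (2 * s + 2) = j + s + 2 ∧ l (2 * s + 2) + s + 1 = j ∧
        σ (j - (s + 1)) = j + s + 2 := by
      have hn1 := hnest (2 * s + 1) (2 * s + 2) (by lia)
      have hn2 := hnest (2 * s + 1) (2 * k - 2) (by lia)
      have hlen2 := hlen (2 * s + 2) (by lia)
      have h1 := hleft (j - (s + 1)) (by lia) (by lia)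
      obtain ⟨t, ht1, ht2, ht3⟩ := H.left_attained (2 * s + 1)
      obtain ⟨u, hu1, hu2, hu3⟩ := H.right_attained (2 * s + 1)
      have ht : t = j - (s + 1) ∨ (l (2 * s + 1) ≤ σ t) := by
        by_cases htl : l (2 * s) ≤ t
        · exact .inr (H.mem (2 * s) t htl (by lia)).1
        · lia
      have hu : u = j - (s + 1) ∨ (σ u ≤ r (2 * s + 1)) := by
        by_cases hul : l (2 * s) ≤ u
        · exact .inr (H.mem (2 * s) u hul (by lia)).2
        · lia
      rw [show 2 * s + 1 + 1 = 2 * s + 2 by lia] at ht3 hu3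
      have hL : l (2 * s + 2) + s + 1 = j := by
        rcases ht with ht | ht
        · rw [ht] at ht3
          lia
        · lia
      rcases hu with hu | hu
      · rw [hu] at hu3
        lia
      · lia
    obtain ⟨e7, e8, e9⟩ := hstep1
    have hstep2 : r (2 * s + 3) = j + s + 2 ∧ l (2 * s + 3) + s + 2 = j ∧
        σ (j + s + 2) + s + 2 = j := by
      have hn1 := hnest (2 * s + 2) (2 * s + 3) (by lia)
      have hn2 := hnest (2 * s + 2) (2 * k - 2) (by lia)
      have hlen2 := hlen (2 * s + 3) (by lia)
      have h1 := hright (j + s + 2) (by lia) (by lia)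
      obtain ⟨t, ht1, ht2, ht3⟩ := H.left_attained (2 * s + 2)
      obtain ⟨u, hu1, hu2, hu3⟩ := H.right_attained (2 * s + 2)
      have ht : t = j + s + 2 ∨ (l (2 * s + 2) ≤ σ t) := by
        by_cases htl : t ≤ r (2 * s + 1)
        · exact .inr (H.mem (2 * s + 1) t (by lia) htl).1
        · lia
      have hu : u = j + s + 2 ∨ (σ u ≤ r (2 * s + 2)) := by
        by_cases hul : u ≤ r (2 * s + 1)
        · exact .inr (H.mem (2 * s + 1) u (by lia) hul).2
        · lia
      rw [show 2 * s + 2 + 1 = 2 * s + 3 by lia] at ht3 hu3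
      have hR : r (2 * s + 3) = j + s + 2 := by
        rcases hu with hu | hu
        · rw [hu] at hu3
          lia
        · lia
      rcases ht with ht | ht
      · rw [ht] at ht3
        lia
      · lia
    rw [show 2 * (s + 1) = 2 * s + 2 by lia, show 2 * s + 2 + 1 = 2 * s + 3 by lia,
      show j + 1 + (s + 1) = j + s + 2 by lia]
    lia

lemma eq_stefanPerm {k : ℕ} (hk : 1 ≤ k) (H : IsHullSeq σ j l r)
    (hσ : SurjOn σ (Icc 1 (2 * k + 1)) (Icc 1 (2 * k + 1)))
    (hlen : ∀ i < 2 * k, r i = l i + i + 1) (hb : ∀ i, 1 ≤ l i ∧ r i ≤ 2 * k + 1)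
    (hleft : ∀ t, l (2 * k - 2) ≤ t → t ≤ j → j + 1 ≤ σ t)
    (hright : ∀ t, j + 1 ≤ t → t ≤ r (2 * k - 2) → σ t ≤ j)
    (hnest : ∀ i i', i ≤ i' → l i' ≤ l i ∧ r i ≤ r i')
    (hl1 : l 1 + 1 = j) : ∀ t ∈ Icc 1 (2 * k + 1), σ t = stefanPerm k t := by
  have key := H.spiral hlen hleft hright hnest hl1
  have hjk : j = k + 1 := by
    have h1 := key (k - 1) (by lia)
    have h2 := hb (2 * (k - 1) + 1)
    lia
  subst hjk
  have hlow : ∀ t, 2 ≤ t → t ≤ k + 1 → σ t = 2 * k + 3 - t := by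
    intro t h1 h2
    obtain ⟨-, -, -, -, h3, -⟩ := key (k + 1 - t) (by lia)
    rw [Nat.sub_sub_self h2] at h3
    lia
  have hhigh : ∀ t, k + 2 ≤ t → t ≤ 2 * k + 1 → σ t = 2 * k + 2 - t := by
    intro t h1 h2
    obtain ⟨-, -, -, -, -, h3⟩ := key (t - (k + 2)) (by lia)
    rw [show k + 1 + 1 + (t - (k + 2)) = t by lia] at h3
    lia
  have hone : σ 1 = k + 1 := by
    obtain ⟨t, ⟨h1, h2⟩, h3⟩ := hσ (⟨by lia, by lia⟩ : k + 1 ∈ Icc 1 (2 * k + 1))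
    obtain rfl : t = 1 := by
      by_contra hne
      rcases le_or_gt t (k + 1) with h4 | h4
      · have := hlow t (by lia) h4
        lia
      · have := hhigh t h4 h2
        lia
    exact h3
  rintro t ⟨h1, h2⟩
  unfold stefanPerm
  split_ifs with h3 h4
  · rw [h3, hone]
  · exact hlow t (by lia) h4
  · exact hhigh t (by lia) h2

end IsHullSeq

/-- If no gap other than `j` is stretched over `j`, then points change sides. -/
lemma change_sides {σ : ℕ → ℕ} {j a b : ℕ} (h1 : j + 1 ≤ σ j) (h2 : σ (j + 1) ≤ j)
    (hc : ∀ K, a ≤ K → K < b → K ≠ j → ¬ GapCovers σ K j) :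
    (∀ t, a ≤ t → t ≤ j → j + 1 ≤ b → j + 1 ≤ σ t) ∧
      (∀ t, a ≤ j → j + 1 ≤ t → t ≤ b → σ t ≤ j) := by
  constructor
  · intro t ht htj hjb
    induction htj using Nat.decreasingInduction with
    | self => exact h1
    | of_succ t htj ih =>
      have h3 := ih (by lia)
      have h4 := hc t ht (by lia) (by lia)
      unfold GapCovers at h4
      lia
  · intro t haj htj htb
    induction t, htj using Nat.le_induction with
    | base => exact h2
    | succ t htj ih =>
      have h3 := ih (by lia)
      have h4 := hc t (by lia) (by lia) (by lia)
      unfold GapCovers at h4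
      lia

/-- A permutation of an odd number of points cannot exchange an initial and a final segment. -/
lemma even_of_exchange {σ : ℕ → ℕ} {n j : ℕ} (hσ : BijOn σ (Icc 1 n) (Icc 1 n)) (hjn : j ≤ n)
    (hleft : ∀ t, 1 ≤ t → t ≤ j → j + 1 ≤ σ t) (hright : ∀ t, j + 1 ≤ t → t ≤ n → σ t ≤ j) :
    n = 2 * j := by
  have hc1 : (Finset.Icc 1 j).card ≤ (Finset.Icc (j + 1) n).card := by
    refine Finset.card_le_card_of_injOn σ (fun t ht => ?_) (hσ.injOn.mono fun t ht => ?_)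
    · rw [Finset.coe_Icc, mem_Icc] at ht
      rw [Finset.coe_Icc, mem_Icc]
      exact ⟨hleft t ht.1 ht.2, (hσ.mapsTo ⟨ht.1, by lia⟩).2⟩
    · rw [Finset.coe_Icc, mem_Icc] at ht
      exact ⟨ht.1, by lia⟩
  have hc2 : (Finset.Icc (j + 1) n).card ≤ (Finset.Icc 1 j).card := by
    refine Finset.card_le_card_of_injOn σ (fun t ht => ?_) (hσ.injOn.mono fun t ht => ?_)
    · rw [Finset.coe_Icc, mem_Icc] at ht
      rw [Finset.coe_Icc, mem_Icc]
      exact ⟨(hσ.mapsTo ⟨by lia, ht.2⟩).1, hright t ht.1 ht.2⟩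
    · rw [Finset.coe_Icc, mem_Icc] at ht
      exact ⟨by lia, ht.2⟩
  simp only [Nat.card_Icc] at hc1 hc2
  lia

/-- Stefan's theorem: a minimal odd orbit has the Stefan permutation or its
reversal conjugate. -/
theorem stefan_theorem (k : ℕ) (hk : 1 ≤ k) (f : ℝ → ℝ) (hf : Continuous f)
    (β : ℕ → ℝ) (σ : ℕ → ℕ) (horb : IsOrbitWithPerm f (2*k+1) β σ)
    (hmin : ∀ q, Odd q → 1 < q → q < 2*k+1 →
      ¬ ∃ y, PeriodicPtOfPeriod f q y ∧
          ∀ j : ℕ, f^[j] y ∈ Set.Icc (β 1) (β (2*k+1))) :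
    (∀ t ∈ Set.Icc 1 (2*k+1), σ t = stefanPerm k t) ∨
    (∀ t ∈ Set.Icc 1 (2*k+1), σ t = 2*k+2 - stefanPerm k (2*k+2 - t)) := by
  obtain ⟨j, hj, hjn, hσj, hσj'⟩ := horb.exists_flipped_gap (by lia)
  obtain ⟨l, r, H⟩ := exists_isHullSeq σ j
  have hb := H.bounds hj hjn horb.2.2.1.mapsTo
  have hnest : ∀ i i', i ≤ i' → l i' ≤ l i ∧ r i ≤ r i' := fun i i' h => H.nested_le hσj hσj' h
  have hgrow := H.growth horb hj hjn hσj hσj'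
  have hl0 := H.left_zero
  have hr0 := H.right_zero
  have hcov : ∀ K, l (2 * k - 2) ≤ K → K < r (2 * k - 2) → K ≠ j → ¬ GapCovers σ K j := by
    intro K h1 h2 h3 hc
    have hbk := hb (2 * k - 2)
    obtain ⟨q, hq1, hq2, hq3, hq4⟩ := horb.exists_periodicPt_of_loop hf (by lia)
      (⟨k - 1, by lia⟩ : Odd (2 * k - 2 + 1)) (by lia) (by lia) hj hjn h3 hc
      (H.gapReached horb hf hj hjn _ K h1 h2)
    exact hmin q hq1 hq2 (by lia) hq4
  obtain ⟨hleft, hright⟩ := change_sides hσj hσj' hcov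
  have hn0 := hnest 0 (2 * k - 2) (by lia)
  replace hleft := fun t h1 h2 => hleft t h1 h2 (by lia)
  replace hright := fun t => hright t (by lia)
  have hlast : r (2 * k - 2) - l (2 * k - 2) < 2 * k := by
    by_contra! hge
    have hbk := hb (2 * k - 2)
    have := even_of_exchange horb.2.2.1 hjn.le (fun t h1 h2 => hleft t (by lia) h2)
      (fun t h1 h2 => hright t h1 (by lia))
    lia
  have hlen : ∀ i < 2 * k, r i = l i + i + 1 := by
    intro i hi
    have h1 := hgrow 0 i
    have hle := H.le i
    have hbi := hb i
    rw [zero_add] at h1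
    rcases Nat.lt_or_ge (2 * k - 2) i with hlt | hge
    · lia
    · have h2 := hgrow i (2 * k - 2 - i)
      rw [Nat.add_sub_cancel' hge] at h2
      lia
  have hl1 : l 1 + 1 = j ∨ r 1 = j + 2 := by
    have h1 := hlen 1 (by lia)
    have h2 := hnest 0 1 (by lia)
    lia
  rcases hl1 with hl1 | hr1
  · exact .inl (H.eq_stefanPerm hk horb.2.2.1.surjOn hlen hb hleft hright hnest hl1)
  · right
    have hperm := fun t => horb.perm_mem (t := t)
    have hst := (H.reflect hb).eq_stefanPerm hk
      (fun t ht => by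
        rw [mem_Icc] at ht
        obtain ⟨u, hu, hut⟩ := horb.2.2.1.surjOn
          (⟨by lia, by lia⟩ : 2 * k + 1 + 1 - t ∈ Icc 1 (2 * k + 1))
        rw [mem_Icc] at hu
        refine ⟨2 * k + 1 + 1 - u, ⟨by lia, by lia⟩, ?_⟩
        change 2 * k + 1 + 1 - σ (2 * k + 1 + 1 - (2 * k + 1 + 1 - u)) = t
        rw [Nat.sub_sub_self (by lia), hut]
        lia)
      (fun i hi => by
        have h1 := hlen i hi
        have h2 := hb i
        lia)
      (fun i => by
        have h1 := hb i
        have h2 := H.le i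
        lia)
      (fun t h1 h2 => by
        have hbk := hb (2 * k - 2)
        have := hright (2 * k + 1 + 1 - t) (by lia) (by lia)
        lia)
      (fun t h1 h2 => by
        have hbk := hb (2 * k - 2)
        have := hleft (2 * k + 1 + 1 - t) (by lia) (by lia)
        lia)
      (fun i i' h => by
        have := hnest i i' h
        lia)
      (by lia)
    intro t ht
    rw [mem_Icc] at ht
    have h1 := hst (2 * k + 2 - t) ⟨by lia, by lia⟩
    have h2 := hperm t ht.1 ht.2
    simp only [show 2 * k + 1 + 1 - (2 * k + 2 - t) = t by lia] at h1
    lia
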